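/- There is no integer x and finite multiset s of integers such that the multiplicity of x in s equals 1 and s = map (fun x => x + 1) s. That is, the constraint set {m(x, s) ≈ 1, s ≈ π(f, s)} with f the integer successor function is unsatisfiable in the theory of finite bags. -/

import Mathlib

theorem stmt_1 :
    ¬ ∃ (x : ℤ) (s : Multiset ℤ),
      Multiset.count x s = 1 ∧ s = Multiset.map (fun x => x + 1) s := by
  rintro ⟨x, s, hx, hs⟩
  have hsum := congrArg Multiset.sum hs
  rw [Multiset.sum_map_add] at hsum
  have hcard : s.card = 0 := by simpa using hsum
  rw [Multiset.card_eq_zero.mp hcard] at hx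
  simp at hx
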